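/- arXiv:2104.01262 — 5 statements merged into one kernel-verified Lean document; each statement's English description precedes it below -/
import Mathlib

section
/- Let B ≠ 0 and define the linear involution h : ℝ³ → ℝ³ by h(x, y, z) = (−B·z, −B·y, −B·x). Then the inverse of the 3D Hénon map F with parameters (M₁, M₂, B), conjugated by h, is the inverse-form 3D Hénon map: for all p ∈ ℝ³, h⁻¹(F⁻¹(h(p))) = G(p), where G has parameters B̂ = 1/B, M̂₁ = M₁/B², M̂₂ = −M₂/B. Equivalently, F(h(G(p))) = h(p) for all p ∈ ℝ³. -/
/-- The 3D Hénon map `F(x, y, z) = (y, z, M₁ + B·x + M₂·y − z²)`. -/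
noncomputable def henon (M₁ M₂ B : ℝ) : ℝ × ℝ × ℝ → ℝ × ℝ × ℝ :=
  fun p => (p.2.1, p.2.2, M₁ + B * p.1 + M₂ * p.2.1 - p.2.2 ^ 2)

/-- The inverse-form 3D Hénon map `G(x, y, z) = (y, z, M̂₁ + B̂·x + M̂₂·z − y²)`. -/
noncomputable def ghenon (M₁ M₂ B : ℝ) : ℝ × ℝ × ℝ → ℝ × ℝ × ℝ :=
  fun p => (p.2.1, p.2.2, M₁ + B * p.1 + M₂ * p.2.2 - p.2.1 ^ 2)

/-- The linear change of coordinates `h(x, y, z) = (−B·z, −B·y, −B·x)`. -/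
noncomputable def hconj (B : ℝ) : ℝ × ℝ × ℝ → ℝ × ℝ × ℝ :=
  fun p => (-B * p.2.2, -B * p.2.1, -B * p.1)

theorem henon_injective (M₁ M₂ : ℝ) {B : ℝ} (hB : B ≠ 0) :
    Function.Injective (henon M₁ M₂ B) := by
  rintro ⟨x, y, z⟩ ⟨x', y', z'⟩ h
  simp only [henon, Prod.mk.injEq] at h ⊢
  obtain ⟨rfl, rfl, h⟩ := h
  exact ⟨mul_left_cancel₀ hB (by linarith), rfl, rfl⟩

theorem hconj_injective {B : ℝ} (hB : B ≠ 0) : Function.Injective (hconj B) := by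
  rintro ⟨x, y, z⟩ ⟨x', y', z'⟩ h
  simp only [hconj, Prod.mk.injEq] at h ⊢
  obtain ⟨hz, hy, hx⟩ := h
  have hB' : -B ≠ 0 := neg_ne_zero.mpr hB
  exact ⟨mul_left_cancel₀ hB' hx, mul_left_cancel₀ hB' hy, mul_left_cancel₀ hB' hz⟩

theorem henon_hconj_ghenon (M₁ M₂ : ℝ) {B : ℝ} (hB : B ≠ 0) (p : ℝ × ℝ × ℝ) :
    henon M₁ M₂ B (hconj B (ghenon (M₁ / B ^ 2) (-M₂ / B) (1 / B) p)) = hconj B p := by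
  obtain ⟨x, y, z⟩ := p
  simp only [henon, hconj, ghenon, Prod.mk.injEq, true_and]
  field_simp
  ring

/-- For `B ≠ 0`, the inverse of the 3D Hénon map `F`, conjugated by `h`, is the
inverse-form 3D Hénon map `G` with parameters `B̂ = 1/B`, `M̂₁ = M₁/B²`, `M̂₂ = −M₂/B`:
`h⁻¹ ∘ F⁻¹ ∘ h = G`, equivalently `F(h(G(p))) = h(p)` for all `p`. -/
theorem henon_inverse_conjugate (M₁ M₂ B : ℝ) (hB : B ≠ 0) :
    (∀ p : ℝ × ℝ × ℝ,
      henon M₁ M₂ B (hconj B (ghenon (M₁ / B ^ 2) (-M₂ / B) (1 / B) p)) = hconj B p) ∧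
    (∀ p : ℝ × ℝ × ℝ,
      Function.invFun (hconj B)
          (Function.invFun (henon M₁ M₂ B) (hconj B p)) =
        ghenon (M₁ / B ^ 2) (-M₂ / B) (1 / B) p) := by
  refine ⟨henon_hconj_ghenon M₁ M₂ hB, fun p => ?_⟩
  rw [← henon_hconj_ghenon M₁ M₂ hB p, Function.leftInverse_invFun (henon_injective M₁ M₂ hB),
    Function.leftInverse_invFun (hconj_injective hB)]
end

section
/- For the parameter values (M₁, M₂, B) = (7/4, −1, −1), the 3D Hénon map F has the fixed point p = (1/2, 1/2, 1/2), and the characteristic polynomial of the Jacobian matrix DF(p) equals (X² + 1)·(X + 1); i.e., over ℂ the fixed point has the triplet of multipliers (i, −i, −1). -/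
open Polynomial

/-- The derivative of the 3D Hénon map. -/
theorem hasFDerivAt_henon (M₁ M₂ B : ℝ) (p : ℝ × ℝ × ℝ) :
    HasFDerivAt (henon M₁ M₂ B)
      (((ContinuousLinearMap.fst ℝ ℝ ℝ).comp (ContinuousLinearMap.snd ℝ ℝ (ℝ × ℝ))).prod
        (((ContinuousLinearMap.snd ℝ ℝ ℝ).comp (ContinuousLinearMap.snd ℝ ℝ (ℝ × ℝ))).prod
          (B • ContinuousLinearMap.fst ℝ ℝ (ℝ × ℝ)
            + M₂ • (ContinuousLinearMap.fst ℝ ℝ ℝ).comp (ContinuousLinearMap.snd ℝ ℝ (ℝ × ℝ))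
            - (2 * p.2.2) •
              (ContinuousLinearMap.snd ℝ ℝ ℝ).comp (ContinuousLinearMap.snd ℝ ℝ (ℝ × ℝ))))) p := by
  have hx : HasFDerivAt (fun q : ℝ × ℝ × ℝ => q.1) (ContinuousLinearMap.fst ℝ ℝ (ℝ × ℝ)) p :=
    hasFDerivAt_fst
  have hyz : HasFDerivAt (fun q : ℝ × ℝ × ℝ => q.2) (ContinuousLinearMap.snd ℝ ℝ (ℝ × ℝ)) p :=
    hasFDerivAt_snd
  have hy := hyz.fst
  have hz := hyz.snd
  refine hy.prodMk (hz.prodMk ?_)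
  refine ((((hx.const_mul B).const_add M₁).add (hy.const_mul M₂)).sub (hz.pow 2)).congr_fderiv ?_
  simp

/-- The linear identification of `ℝ × ℝ × ℝ` with `Fin 3 → ℝ`. -/
def prodProdEquivFinThree : (ℝ × ℝ × ℝ) ≃ₗ[ℝ] (Fin 3 → ℝ) where
  toFun p := ![p.1, p.2.1, p.2.2]
  invFun v := (v 0, v 1, v 2)
  map_add' p q := by ext i; fin_cases i <;> rfl
  map_smul' c p := by ext i; fin_cases i <;> rfl
  left_inv p := rfl
  right_inv v := by ext i; fin_cases i <;> rfl

@[simp]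
theorem prodProdEquivFinThree_apply (p : ℝ × ℝ × ℝ) :
    prodProdEquivFinThree p = ![p.1, p.2.1, p.2.2] := rfl

@[simp]
theorem prodProdEquivFinThree_symm_apply (v : Fin 3 → ℝ) :
    prodProdEquivFinThree.symm v = (v 0, v 1, v 2) := rfl

/-- The characteristic polynomial of the Jacobian of the 3D Hénon map. -/
theorem charpoly_fderiv_henon (M₁ M₂ B : ℝ) (p : ℝ × ℝ × ℝ) :
    LinearMap.charpoly (fderiv ℝ (henon M₁ M₂ B) p).toLinearMap =
      X ^ 3 + C (2 * p.2.2) * X ^ 2 - C M₂ * X - C B := by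
  rw [(hasFDerivAt_henon M₁ M₂ B p).fderiv,
    ← LinearMap.charpoly_toMatrix _ (Module.Basis.ofEquivFun prodProdEquivFinThree)]
  have hJ : LinearMap.toMatrix (Module.Basis.ofEquivFun prodProdEquivFinThree)
      (Module.Basis.ofEquivFun prodProdEquivFinThree)
      (((ContinuousLinearMap.fst ℝ ℝ ℝ).comp (ContinuousLinearMap.snd ℝ ℝ (ℝ × ℝ))).prod
        (((ContinuousLinearMap.snd ℝ ℝ ℝ).comp (ContinuousLinearMap.snd ℝ ℝ (ℝ × ℝ))).prod
          (B • ContinuousLinearMap.fst ℝ ℝ (ℝ × ℝ)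
            + M₂ • (ContinuousLinearMap.fst ℝ ℝ ℝ).comp (ContinuousLinearMap.snd ℝ ℝ (ℝ × ℝ))
            - (2 * p.2.2) • (ContinuousLinearMap.snd ℝ ℝ ℝ).comp
              (ContinuousLinearMap.snd ℝ ℝ (ℝ × ℝ))))).toLinearMap =
      !![0, 1, 0; 0, 0, 1; B, M₂, -(2 * p.2.2)] := by
    ext i j
    fin_cases i <;> fin_cases j <;>
      simp [LinearMap.toMatrix_apply]
  rw [hJ, Matrix.charpoly, Matrix.det_fin_three]
  simp
  ring


/-- For `(M₁, M₂, B) = (7/4, −1, −1)` the 3D Hénon map has the fixed point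
`(1/2, 1/2, 1/2)`, and the characteristic polynomial of the Jacobian there is
`(X² + 1)·(X + 1)`; over `ℂ` the multipliers are `(i, −i, −1)`. -/
theorem henon_fixed_point_i_minus_i_minus_one :
    henon (7/4) (-1) (-1) (1/2, 1/2, 1/2) = (1/2, 1/2, 1/2) ∧
    LinearMap.charpoly (fderiv ℝ (henon (7/4) (-1) (-1)) (1/2, 1/2, 1/2)).toLinearMap =
      (X ^ 2 + 1) * (X + 1) := by
  refine ⟨by norm_num [henon], ?_⟩
  rw [charpoly_fderiv_henon]
  norm_num
  ring
end

section
/- For every choice of parameters (M̂₁, M̂₂, B̂) ∈ ℝ³ there is no point p ∈ ℝ³ of exact period 2 for the inverse-form 3D Hénon map G (i.e., G(G(p)) = p and G(p) ≠ p) such that the characteristic polynomial of the Jacobian matrix D(G²)(p) equals (X − 1)·(X + 1)²; i.e., G has no period-2 orbit whose second-iterate multipliers are (−1, −1, +1). -/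
open Polynomial

theorem hasFDerivAt_ghenon (M₁ M₂ B : ℝ) (p : ℝ × ℝ × ℝ) :
    ∃ L : ℝ × ℝ × ℝ →L[ℝ] ℝ × ℝ × ℝ, HasFDerivAt (ghenon M₁ M₂ B) L p ∧
      ∀ v, L v = (v.2.1, v.2.2, B * v.1 + M₂ * v.2.2 - 2 * p.2.1 * v.2.1) := by
  have hx := hasFDerivAt_fst (𝕜 := ℝ) (p := p)
  have hyz := hasFDerivAt_snd (𝕜 := ℝ) (p := p)
  have hy := hyz.fst
  have hz := hyz.snd
  refine ⟨_, hy.prodMk (hz.prodMk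
    ((((hx.const_mul B).const_add M₁).add (hz.const_mul M₂)).sub (hy.pow 2))), fun v => ?_⟩
  simp

/-- The coordinates of `ℝ × ℝ × ℝ`. -/
noncomputable def prodEquivFinThree : (ℝ × ℝ × ℝ) ≃ₗ[ℝ] (Fin 3 → ℝ) where
  toFun p := ![p.1, p.2.1, p.2.2]
  invFun v := (v 0, v 1, v 2)
  map_add' p q := by ext i; fin_cases i <;> simp
  map_smul' c p := by ext i; fin_cases i <;> simp
  left_inv p := by simp
  right_inv v := by ext i; fin_cases i <;> simp

/-- The Jacobian matrix of the second iterate of the Hénon map at a point with second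
coordinate `y` and third coordinate `z`. -/
def ghenonSqJacobian (M₂ B y z : ℝ) : Matrix (Fin 3) (Fin 3) ℝ :=
  !![0, 0, 1; B, -2 * y, M₂; M₂ * B, B - 2 * y * M₂, M₂ ^ 2 - 2 * z]

theorem charpoly_fderiv_ghenon_comp_ghenon (M₁ M₂ B : ℝ) (p : ℝ × ℝ × ℝ) :
    LinearMap.charpoly (fderiv ℝ (ghenon M₁ M₂ B ∘ ghenon M₁ M₂ B) p).toLinearMap =
      (ghenonSqJacobian M₂ B p.2.1 p.2.2).charpoly := by
  obtain ⟨L, hL, hLv⟩ := hasFDerivAt_ghenon M₁ M₂ B p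
  obtain ⟨K, hK, hKv⟩ := hasFDerivAt_ghenon M₁ M₂ B (ghenon M₁ M₂ B p)
  rw [(hK.comp p hL).fderiv, ← LinearEquiv.charpoly_conj prodEquivFinThree,
    ← Matrix.charpoly_toLin']
  congr 1
  refine LinearMap.ext fun v => ?_
  ext i
  fin_cases i <;>
    simp [LinearEquiv.conj_apply, hLv, hKv, prodEquivFinThree, ghenonSqJacobian, ghenon,
      Matrix.mulVec, dotProduct, Fin.sum_univ_three] <;> ring

/-- For no parameter values does the inverse-form 3D Hénon map have a point of exact
period 2 whose second-iterate Jacobian has characteristic polynomial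
`(X − 1)·(X + 1)²`, i.e. multipliers `(−1, −1, +1)`. -/
theorem ghenon_no_period_two_with_multipliers (M₁ M₂ B : ℝ) (p : ℝ × ℝ × ℝ)
    (hper : ghenon M₁ M₂ B (ghenon M₁ M₂ B p) = p)
    (hfix : ghenon M₁ M₂ B p ≠ p) :
    LinearMap.charpoly
        (fderiv ℝ (ghenon M₁ M₂ B ∘ ghenon M₁ M₂ B) p).toLinearMap ≠
      (X - 1) * (X + 1) ^ 2 := by
  rw [charpoly_fderiv_ghenon_comp_ghenon]
  intro hchar
  have heval (t : ℝ) := congrArg (Polynomial.eval t) hchar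
  have h₀ := heval 0
  have h₁ := heval 1
  have h₂ := heval (-1)
  clear heval hchar
  obtain ⟨x, y, z⟩ := p
  simp only [ghenon, Prod.mk.injEq] at hper
  obtain ⟨rfl, hy, hz⟩ := hper
  have hne : z ≠ y := by
    rintro rfl
    exact hfix (by simp [ghenon, hy])
  simp [Matrix.eval_charpoly, ghenonSqJacobian, Matrix.det_fin_three] at h₀ h₁ h₂
  rw [hy] at hz
  have hsum : z + y = -(1 + B + M₂) :=
    mul_left_cancel₀ (sub_ne_zero.mpr hne) (by linear_combination hy - hz)
  have hdet : B ^ 2 = 1 := by linear_combination -h₀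
  have htrace : M₂ ^ 2 - 2 * (z + y) = -1 := by
    linear_combination -(h₁ + h₂) / 2 + h₀
  have hminor : 4 * z * y - 2 * M₂ * B = -1 := by
    linear_combination (h₁ - h₂) / 2
  rw [hsum] at htrace
  obtain rfl | rfl := eq_or_eq_neg_of_sq_eq_sq B 1 (by rw [hdet, one_pow])
  · nlinarith [sq_nonneg (M₂ + 1)]
  · have hM : M₂ = -1 := by nlinarith [sq_nonneg (M₂ + 1)]
    subst hM
    have hsq : (z - y) ^ 2 = 0 := by
      linear_combination (z + y + 1) * hsum - hminor
    exact hne (sub_eq_zero.mp (pow_eq_zero_iff two_ne_zero |>.mp hsq))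
end

section
/- There exist real parameters M̂₁, M̂₂ (numerically M̂₁ ≈ 0.3974562084897318, M̂₂ ≈ 0.2271356235631268) such that for B̂ = −1 the inverse-form 3D Hénon map G has a point p ∈ ℝ³ of exact period 6 (G⁶(p) = p and Gʲ(p) ≠ p for 1 ≤ j ≤ 5) at which trace D(G⁶)(p) = −1 and det(D(G⁶)(p) − I) = 0; since det D(G⁶)(p) = B̂⁶ = 1, the Jacobian of the sixth iterate at p has eigenvalues (−1, −1, +1). -/
open Polynomial

section FixedPoint

open Metric

variable {n : ℕ}

/-- A matrix with absolute row sums at most `b` is bounded by `b` in the sup norm. -/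
lemma norm_mulVec_le_of_row_sum_le (B : Matrix (Fin n) (Fin n) ℝ) {b : ℝ} (hb : 0 ≤ b)
    (hB : ∀ i, ∑ j, |B i j| ≤ b) (h : Fin n → ℝ) : ‖B.mulVec h‖ ≤ b * ‖h‖ := by
  rw [pi_norm_le_iff_of_nonneg (by positivity)]
  intro i
  calc ‖B.mulVec h i‖ ≤ ∑ j, ‖B i j * h j‖ := norm_sum_le Finset.univ fun j => B i j * h j
    _ ≤ ∑ j, |B i j| * ‖h‖ := by
        refine Finset.sum_le_sum fun j _ => ?_
        rw [norm_mul, Real.norm_eq_abs (B i j)]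
        exact mul_le_mul_of_nonneg_left (norm_le_pi_norm h j) (abs_nonneg _)
    _ = (∑ j, |B i j|) * ‖h‖ := by rw [Finset.sum_mul]
    _ ≤ b * ‖h‖ := mul_le_mul_of_nonneg_right (hB i) (norm_nonneg _)

/-- A left factor of a matrix close to the identity is injective. -/
lemma eq_zero_of_mulVec_eq_zero_of_row_sum_le (A L : Matrix (Fin n) (Fin n) ℝ)
    (hAL : ∀ i, ∑ j, |(1 - A * L) i j| ≤ 1 / 4) {w : Fin n → ℝ} (hw : A.mulVec w = 0) :
    w = 0 := by
  have hdet : (A * L).det ≠ 0 := by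
    intro h0
    obtain ⟨h, hne, hh⟩ := Matrix.exists_mulVec_eq_zero_iff.mpr h0
    have h1 : (1 - A * L).mulVec h = h := by
      rw [Matrix.sub_mulVec, hh, Matrix.one_mulVec, sub_zero]
    have h2 := norm_mulVec_le_of_row_sum_le _ (by norm_num) hAL h
    rw [h1] at h2
    have h3 : 0 < ‖h‖ := norm_pos_iff.mpr hne
    linarith
  rw [Matrix.det_mul] at hdet
  exact Matrix.eq_zero_of_mulVec_eq_zero (left_ne_zero_of_mul hdet) hw

/-- A Newton–Kantorovich type criterion: `F` has a zero near `c` when `F c` is small, `F` is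
close to the linear map `L` near `c`, and `A` is an approximate inverse of `L`. -/
lemma exists_zero_of_approximate_inverse (F : (Fin n → ℝ) → Fin n → ℝ)
    (A L : Matrix (Fin n) (Fin n) ℝ) (c : Fin n → ℝ) {r K κ δ : ℝ}
    (hr : 0 ≤ r) (hK : 0 ≤ K) (hκ : 0 ≤ κ) (hδ : 0 ≤ δ)
    (hAL : ∀ i, ∑ j, |(1 - A * L) i j| ≤ 1 / 4) (hA : ∀ i, ∑ j, |A i j| ≤ K)
    (hF : ∀ u ∈ closedBall c r, ∀ v ∈ closedBall c r, ∀ i,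
      |F u i - F v i - L.mulVec (u - v) i| ≤ κ * ‖u - v‖)
    (hc : ∀ i, |F c i| ≤ δ) (hKκ : K * κ ≤ 1 / 4) (hKδ : K * δ ≤ r / 2) :
    ∃ u ∈ closedBall c r, F u = 0 := by
  have happrox : ApproximatesLinearOn (fun u => A.mulVec (F u))
      (ContinuousLinearEquiv.refl ℝ (Fin n → ℝ) : (Fin n → ℝ) →L[ℝ] Fin n → ℝ)
      (closedBall c r) (1 / 2) := by
    intro u hu v hv
    have h1 : A.mulVec (F u) - A.mulVec (F v) - (u - v) =
        A.mulVec (F u - F v - L.mulVec (u - v)) - (1 - A * L).mulVec (u - v) := by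
      rw [Matrix.sub_mulVec, Matrix.one_mulVec, Matrix.mulVec_sub, Matrix.mulVec_sub,
        Matrix.mulVec_mulVec]
      abel
    have h2 : ‖F u - F v - L.mulVec (u - v)‖ ≤ κ * ‖u - v‖ := by
      rw [pi_norm_le_iff_of_nonneg (by positivity)]
      exact hF u hu v hv
    have h3 := norm_mulVec_le_of_row_sum_le A hK hA (F u - F v - L.mulVec (u - v))
    have h4 := norm_mulVec_le_of_row_sum_le _ (by norm_num) hAL (u - v)
    have h5 : K * ‖F u - F v - L.mulVec (u - v)‖ ≤ 1 / 4 * ‖u - v‖ := by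
      calc _ ≤ K * (κ * ‖u - v‖) := mul_le_mul_of_nonneg_left h2 hK
        _ = K * κ * ‖u - v‖ := by ring
        _ ≤ _ := mul_le_mul_of_nonneg_right hKκ (norm_nonneg _)
    have h6 := norm_sub_le (A.mulVec (F u - F v - L.mulVec (u - v)))
      ((1 - A * L).mulVec (u - v))
    change ‖A.mulVec (F u) - A.mulVec (F v) - (u - v)‖ ≤ _
    rw [h1]
    push_cast
    linarith
  have hsurj := happrox.surjOn_closedBall_of_nonlinearRightInverse
    { toFun := id, nnnorm := 1, bound' := by simp, right_inv' := by intro y; simp }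
    hr subset_rfl
  have hzero : (0 : Fin n → ℝ) ∈ closedBall (A.mulVec (F c)) (((1 : ℝ)⁻¹ - 1 / 2) * r) := by
    rw [mem_closedBall, dist_comm, dist_zero_right]
    have h1 : ‖F c‖ ≤ δ := (pi_norm_le_iff_of_nonneg hδ).mpr hc
    have h2 := norm_mulVec_le_of_row_sum_le A hK hA (F c)
    have h3 := mul_le_mul_of_nonneg_left h1 hK
    linarith
  obtain ⟨u, hu, h0⟩ := hsurj hzero
  exact ⟨u, hu, eq_zero_of_mulVec_eq_zero_of_row_sum_le A L hAL h0⟩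

end FixedPoint

section ApproximateSolution

open Metric

/-- The equations for a period-six orbit `u 0, …, u 5` with parameters `M̂₁ = u 6`, `M̂₂ = u 7`,
together with a periodic tangent orbit `1, u 8, …, u 12` and an antiperiodic tangent orbit
`u 13, u 14, u 15, 1, u 16, u 17`. -/
def periodSixSystem (u : Fin 18 → ℝ) : Fin 18 → ℝ :=
  ![u 3 - (u 6 - u 0 + u 7 * u 2 - u 1 ^ 2),
    u 4 - (u 6 - u 1 + u 7 * u 3 - u 2 ^ 2),
    u 5 - (u 6 - u 2 + u 7 * u 4 - u 3 ^ 2),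
    u 0 - (u 6 - u 3 + u 7 * u 5 - u 4 ^ 2),
    u 1 - (u 6 - u 4 + u 7 * u 0 - u 5 ^ 2),
    u 2 - (u 6 - u 5 + u 7 * u 1 - u 0 ^ 2),
    u 10 + 1 + 2 * u 1 * u 8 - u 7 * u 9,
    u 11 + u 8 + 2 * u 2 * u 9 - u 7 * u 10,
    u 12 + u 9 + 2 * u 3 * u 10 - u 7 * u 11,
    1 + u 10 + 2 * u 4 * u 11 - u 7 * u 12,
    u 8 + u 11 + 2 * u 5 * u 12 - u 7,
    u 9 + u 12 + 2 * u 0 - u 7 * u 8,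
    1 + u 13 + 2 * u 1 * u 14 - u 7 * u 15,
    u 16 + u 14 + 2 * u 2 * u 15 - u 7,
    u 17 + u 15 + 2 * u 3 - u 7 * u 16,
    -u 13 + 1 + 2 * u 4 * u 16 - u 7 * u 17,
    -u 14 + u 16 + 2 * u 5 * u 17 + u 7 * u 13,
    -u 15 + u 17 - 2 * u 0 * u 13 + u 7 * u 14]

/-- An approximate zero of `periodSixSystem`, scaled by `10 ^ 6`. -/
def approxZero : Fin 18 → ℤ :=
  ![1110909, 543080, -18564, -1012605, -375968, -694745, 397456, 227136, -281006, -1888051,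
    -1123626, -44310, -397593, -616, -701895, 1043485, 967774, 1201542]

/-- The row vector with the single entry `a` in position `k`. -/
def rowEntry (k : Fin 18) (a : ℤ) : Fin 18 → ℤ :=
  Pi.single k a

/-- The derivative of `periodSixSystem` at the approximate zero, scaled by `10 ^ 6`. -/
def approxDeriv : Matrix (Fin 18) (Fin 18) ℤ :=
  Matrix.of ![
    rowEntry 3 1000000 + rowEntry 0 1000000 + rowEntry 6 (-1000000) +
      rowEntry 7 (-approxZero 2) + rowEntry 2 (-approxZero 7) + rowEntry 1 (2 * approxZero 1),
    rowEntry 4 1000000 + rowEntry 1 1000000 + rowEntry 6 (-1000000) +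
      rowEntry 7 (-approxZero 3) + rowEntry 3 (-approxZero 7) + rowEntry 2 (2 * approxZero 2),
    rowEntry 5 1000000 + rowEntry 2 1000000 + rowEntry 6 (-1000000) +
      rowEntry 7 (-approxZero 4) + rowEntry 4 (-approxZero 7) + rowEntry 3 (2 * approxZero 3),
    rowEntry 0 1000000 + rowEntry 3 1000000 + rowEntry 6 (-1000000) +
      rowEntry 7 (-approxZero 5) + rowEntry 5 (-approxZero 7) + rowEntry 4 (2 * approxZero 4),
    rowEntry 1 1000000 + rowEntry 4 1000000 + rowEntry 6 (-1000000) +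
      rowEntry 7 (-approxZero 0) + rowEntry 0 (-approxZero 7) + rowEntry 5 (2 * approxZero 5),
    rowEntry 2 1000000 + rowEntry 5 1000000 + rowEntry 6 (-1000000) +
      rowEntry 7 (-approxZero 1) + rowEntry 1 (-approxZero 7) + rowEntry 0 (2 * approxZero 0),
    rowEntry 10 1000000 + rowEntry 1 (2 * approxZero 8) + rowEntry 8 (2 * approxZero 1) +
      rowEntry 7 (-approxZero 9) + rowEntry 9 (-approxZero 7),
    rowEntry 11 1000000 + rowEntry 8 1000000 + rowEntry 2 (2 * approxZero 9) +
      rowEntry 9 (2 * approxZero 2) + rowEntry 7 (-approxZero 10) + rowEntry 10 (-approxZero 7),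
    rowEntry 12 1000000 + rowEntry 9 1000000 + rowEntry 3 (2 * approxZero 10) +
      rowEntry 10 (2 * approxZero 3) + rowEntry 7 (-approxZero 11) +
      rowEntry 11 (-approxZero 7),
    rowEntry 10 1000000 + rowEntry 4 (2 * approxZero 11) + rowEntry 11 (2 * approxZero 4) +
      rowEntry 7 (-approxZero 12) + rowEntry 12 (-approxZero 7),
    rowEntry 8 1000000 + rowEntry 11 1000000 + rowEntry 5 (2 * approxZero 12) +
      rowEntry 12 (2 * approxZero 5) + rowEntry 7 (-1000000),
    rowEntry 9 1000000 + rowEntry 12 1000000 + rowEntry 0 2000000 +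
      rowEntry 7 (-approxZero 8) + rowEntry 8 (-approxZero 7),
    rowEntry 13 1000000 + rowEntry 1 (2 * approxZero 14) + rowEntry 14 (2 * approxZero 1) +
      rowEntry 7 (-approxZero 15) + rowEntry 15 (-approxZero 7),
    rowEntry 16 1000000 + rowEntry 14 1000000 + rowEntry 2 (2 * approxZero 15) +
      rowEntry 15 (2 * approxZero 2) + rowEntry 7 (-1000000),
    rowEntry 17 1000000 + rowEntry 15 1000000 + rowEntry 3 2000000 +
      rowEntry 7 (-approxZero 16) + rowEntry 16 (-approxZero 7),
    rowEntry 13 (-1000000) + rowEntry 4 (2 * approxZero 16) + rowEntry 16 (2 * approxZero 4) +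
      rowEntry 7 (-approxZero 17) + rowEntry 17 (-approxZero 7),
    rowEntry 14 (-1000000) + rowEntry 16 1000000 + rowEntry 5 (2 * approxZero 17) +
      rowEntry 17 (2 * approxZero 5) + rowEntry 7 (approxZero 13) + rowEntry 13 (approxZero 7),
    rowEntry 15 (-1000000) + rowEntry 17 1000000 + rowEntry 0 (-2 * approxZero 13) +
      rowEntry 13 (-2 * approxZero 0) + rowEntry 7 (approxZero 14) + rowEntry 14 (approxZero 7)]

/-- An approximate inverse of the derivative of `periodSixSystem`, scaled by `10 ^ 2`. -/
def approxInverse : Matrix (Fin 18) (Fin 18) ℤ :=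
  !![-20, 0, -29, -8, -3, 59, -11, 15, 0, 15, -4, -2, -22, 10, -14, -5, -17, -10;
    103, -20, 14, -59, -16, -22, 3, -4, 0, -4, 1, 1, -15, 7, -10, -3, -11, -7;
    13, 1, 5, -5, -6, -8, 20, -28, -1, -28, 7, 4, 0, 0, 0, 0, 0, 0;
    26, 10, -18, 15, -11, -22, 12, -17, 0, -16, 4, 2, 18, -8, 12, 4, 13, 8;
    -53, 67, -38, -17, 9, 32, 0, -1, 0, -1, 0, 0, 7, -3, 5, 2, 5, 3;
    52, 6, 22, -33, -35, -13, 4, -6, 0, -6, 1, 1, 21, -9, 13, 4, 15, 9;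
    14, -11, -33, -56, -30, 16, 0, 0, 0, 0, 0, 0, -21, 9, -14, -4, -16, -9;
    -29, 44, -13, 24, -25, 0, 0, 0, 0, 0, 0, 0, -9, 4, -6, -2, -7, -4;
    101, -56, -4, -50, 12, -3, 84, -11, 39, -7, 15, -21, 13, -6, 9, 3, 10, 6;
    18, 45, 31, 32, -29, -97, -13, -30, 16, 38, 63, 80, 46, -21, 30, 9, 34, 20;
    7, -23, 44, -17, 20, -30, 7, 2, -39, 14, -1, 41, 5, -2, 3, 1, 4, 2;
    -15, 6, 48, 2, -2, -38, -6, 4, -50, -94, 14, 49, 0, 0, 0, 0, 0, 0;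
    52, -71, 28, -33, 45, -22, 53, -2, -8, -69, -52, 20, 4, -2, 3, 1, 3, 2;
    31, 24, -16, -63, 11, 12, 17, -24, 0, -24, 6, 4, 40, -38, 2, -45, 4, -6;
    61, -11, 27, 17, -57, -37, -20, 27, 1, 27, -7, -4, 13, 61, -12, 46, -29, -18;
    -71, -25, 32, 61, -7, 10, -36, 50, 1, 50, -13, -7, -65, 63, 35, 46, -20, -52;
    -121, 52, -49, 20, 43, 54, -24, 33, 1, 33, -8, -5, -25, 46, 8, -46, 22, 12;
    -36, 60, -19, -65, 14, 45, 7, -9, 0, -9, 2, 1, 15, -33, 38, -66, -8, 36]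

lemma approxInverse_mul_approxDeriv_row_sum (i : Fin 18) :
    ∑ j, |(10 ^ 8 * (if i = j then 1 else 0) - ∑ k, approxInverse i k * approxDeriv k j : ℤ)| ≤
      25000000 := by
  revert i
  decide +kernel

lemma approxInverse_row_sum (i : Fin 18) : ∑ j, |approxInverse i j| ≤ 700 := by
  revert i
  decide +kernel

/-- Linearization error of a product near `(c, d)`. -/
lemma abs_mul_sub_mul_sub_le {a b a' b' c d r N : ℝ} (ha : |a - c| ≤ r) (hb' : |b' - d| ≤ r)
    (hab : |a - a'| ≤ N) (hbb : |b - b'| ≤ N) :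
    |a * b - a' * b' - c * (b - b') - d * (a - a')| ≤ 2 * r * N := by
  have hr : 0 ≤ r := (abs_nonneg _).trans ha
  have h : a * b - a' * b' - c * (b - b') - d * (a - a') =
      (a - c) * (b - b') + (b' - d) * (a - a') := by ring
  rw [h]
  refine (abs_add_le _ _).trans ?_
  rw [abs_mul, abs_mul]
  have h1 := mul_le_mul ha hbb (abs_nonneg _) hr
  have h2 := mul_le_mul hb' hab (abs_nonneg _) hr
  linarith

lemma periodSixSystem_approximates {u v : Fin 18 → ℝ}
    (hu : u ∈ closedBall (fun i => (approxZero i : ℝ) / 10 ^ 6) (1 / 10 ^ 4))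
    (hv : v ∈ closedBall (fun i => (approxZero i : ℝ) / 10 ^ 6) (1 / 10 ^ 4)) (i : Fin 18) :
    |periodSixSystem u i - periodSixSystem v i -
      (Matrix.of fun i j => (approxDeriv i j : ℝ) / 10 ^ 6).mulVec (u - v) i| ≤
      1 / 10 ^ 3 * ‖u - v‖ := by
  have key : ∀ a b, |u a * u b - v a * v b - (approxZero a : ℝ) / 10 ^ 6 * (u b - v b) -
      (approxZero b : ℝ) / 10 ^ 6 * (u a - v a)| ≤ 2 * (1 / 10 ^ 4) * ‖u - v‖ := by
    intro a b
    refine abs_mul_sub_mul_sub_le ?_ ?_ (norm_le_pi_norm (u - v) a) (norm_le_pi_norm (u - v) b)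
    · exact (dist_le_pi_dist u _ a).trans hu
    · exact (dist_le_pi_dist v _ b).trans hv
  have hN := norm_nonneg (u - v)
  rw [abs_le]
  fin_cases i <;>
    simp only [Fin.reduceFinMk, periodSixSystem, approxDeriv, Matrix.mulVec, dotProduct,
      Matrix.of_apply, Matrix.cons_val, Pi.add_apply, Pi.sub_apply, rowEntry, Int.cast_add,
      add_div, add_mul, Finset.sum_add_distrib, Pi.single_apply, Int.cast_ite, ite_div, ite_mul,
      Int.cast_zero, zero_div, zero_mul, Finset.sum_ite_eq', Finset.mem_univ, if_true] <;>
    push_cast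
  · have h₁ := abs_le.mp (key 7 2)
    have h₂ := abs_le.mp (key 1 1)
    constructor <;> linarith
  · have h₁ := abs_le.mp (key 7 3)
    have h₂ := abs_le.mp (key 2 2)
    constructor <;> linarith
  · have h₁ := abs_le.mp (key 7 4)
    have h₂ := abs_le.mp (key 3 3)
    constructor <;> linarith
  · have h₁ := abs_le.mp (key 7 5)
    have h₂ := abs_le.mp (key 4 4)
    constructor <;> linarith
  · have h₁ := abs_le.mp (key 7 0)
    have h₂ := abs_le.mp (key 5 5)
    constructor <;> linarith
  · have h₁ := abs_le.mp (key 7 1)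
    have h₂ := abs_le.mp (key 0 0)
    constructor <;> linarith
  · have h₁ := abs_le.mp (key 1 8)
    have h₂ := abs_le.mp (key 7 9)
    constructor <;> linarith
  · have h₁ := abs_le.mp (key 2 9)
    have h₂ := abs_le.mp (key 7 10)
    constructor <;> linarith
  · have h₁ := abs_le.mp (key 3 10)
    have h₂ := abs_le.mp (key 7 11)
    constructor <;> linarith
  · have h₁ := abs_le.mp (key 4 11)
    have h₂ := abs_le.mp (key 7 12)
    constructor <;> linarith
  · have h₁ := abs_le.mp (key 5 12)
    constructor <;> linarith
  · have h₁ := abs_le.mp (key 7 8)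
    constructor <;> linarith
  · have h₁ := abs_le.mp (key 1 14)
    have h₂ := abs_le.mp (key 7 15)
    constructor <;> linarith
  · have h₁ := abs_le.mp (key 2 15)
    constructor <;> linarith
  · have h₁ := abs_le.mp (key 7 16)
    constructor <;> linarith
  · have h₁ := abs_le.mp (key 4 16)
    have h₂ := abs_le.mp (key 7 17)
    constructor <;> linarith
  · have h₁ := abs_le.mp (key 5 17)
    have h₂ := abs_le.mp (key 7 13)
    constructor <;> linarith
  · have h₁ := abs_le.mp (key 0 13)
    have h₂ := abs_le.mp (key 7 14)
    constructor <;> linarith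

lemma periodSixSystem_approxZero (i : Fin 18) :
    |periodSixSystem (fun i => (approxZero i : ℝ) / 10 ^ 6) i| ≤ 2 / 10 ^ 6 := by
  rw [abs_le]
  fin_cases i <;> simp only [Fin.reduceFinMk, periodSixSystem, approxZero, Matrix.cons_val] <;>
    norm_num

lemma exists_periodSixSystem_eq_zero :
    ∃ u ∈ closedBall (fun i => (approxZero i : ℝ) / 10 ^ 6) (1 / 10 ^ 4),
      periodSixSystem u = 0 := by
  refine exists_zero_of_approximate_inverse periodSixSystem
    (Matrix.of fun i j => (approxInverse i j : ℝ) / 10 ^ 2)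
    (Matrix.of fun i j => (approxDeriv i j : ℝ) / 10 ^ 6) _
    (K := 7) (κ := 1 / 10 ^ 3) (δ := 2 / 10 ^ 6) (by norm_num) (by norm_num) (by norm_num)
    (by norm_num) ?_ ?_ (fun u hu v hv i => periodSixSystem_approximates hu hv i)
    periodSixSystem_approxZero (by norm_num) (by norm_num)
  · intro i
    have h : ∀ j, |(1 - (Matrix.of fun i j => (approxInverse i j : ℝ) / 10 ^ 2) *
        (Matrix.of fun i j => (approxDeriv i j : ℝ) / 10 ^ 6) : Matrix (Fin 18) (Fin 18) ℝ) i j| =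
        ((|10 ^ 8 * (if i = j then 1 else 0) - ∑ k, approxInverse i k * approxDeriv k j| : ℤ) : ℝ) /
          10 ^ 8 := by
      intro j
      have h8 : (0 : ℝ) < 10 ^ 8 := by norm_num
      rw [eq_div_iff h8.ne', Int.cast_abs, ← abs_of_pos h8, ← abs_mul]
      congr 1
      push_cast
      rw [Matrix.sub_apply, Matrix.one_apply, Matrix.mul_apply, sub_mul, Finset.sum_mul]
      congr 1
      · ring
      · refine Finset.sum_congr rfl fun k _ => ?_
        simp only [Matrix.of_apply]
        ring
    simp_rw [h]
    rw [← Finset.sum_div, ← Int.cast_sum, div_le_iff₀ (by norm_num)]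
    have := approxInverse_mul_approxDeriv_row_sum i
    calc _ ≤ ((25000000 : ℤ) : ℝ) := Int.cast_le.mpr this
      _ ≤ _ := by norm_num
  · intro i
    simp only [Matrix.of_apply, abs_div, ← Int.cast_abs]
    rw [← Finset.sum_div, ← Int.cast_sum, abs_of_pos (by norm_num), div_le_iff₀ (by norm_num)]
    calc _ ≤ ((700 : ℤ) : ℝ) := Int.cast_le.mpr (approxInverse_row_sum i)
      _ ≤ _ := by norm_num

end ApproximateSolution

section Henon

/-- The derivative of `ghenon M₁ m (-1)` at a point with second coordinate `y`. -/
noncomputable def ghenonDeriv (m y : ℝ) : (ℝ × ℝ × ℝ) →L[ℝ] ℝ × ℝ × ℝ :=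
  ((ContinuousLinearMap.fst ℝ ℝ ℝ).comp (ContinuousLinearMap.snd ℝ ℝ (ℝ × ℝ))).prod
    (((ContinuousLinearMap.snd ℝ ℝ ℝ).comp (ContinuousLinearMap.snd ℝ ℝ (ℝ × ℝ))).prod
      (-ContinuousLinearMap.fst ℝ ℝ (ℝ × ℝ) +
        m • (ContinuousLinearMap.snd ℝ ℝ ℝ).comp (ContinuousLinearMap.snd ℝ ℝ (ℝ × ℝ)) -
        (2 * y) • (ContinuousLinearMap.fst ℝ ℝ ℝ).comp (ContinuousLinearMap.snd ℝ ℝ (ℝ × ℝ))))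

lemma ghenonDeriv_apply (m y a b c : ℝ) :
    ghenonDeriv m y (a, b, c) = (b, c, -a + m * c - 2 * y * b) := by
  simp [ghenonDeriv]

lemma hasFDerivAt_ghenon_s16 (M m : ℝ) (p : ℝ × ℝ × ℝ) :
    HasFDerivAt (ghenon M m (-1)) (ghenonDeriv m p.2.1) p := by
  have h₁ : HasFDerivAt (fun q : ℝ × ℝ × ℝ => q.1) (ContinuousLinearMap.fst ℝ ℝ (ℝ × ℝ)) p :=
    hasFDerivAt_fst
  have h₂ : HasFDerivAt (fun q : ℝ × ℝ × ℝ => q.2.1)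
      ((ContinuousLinearMap.fst ℝ ℝ ℝ).comp (ContinuousLinearMap.snd ℝ ℝ (ℝ × ℝ))) p :=
    hasFDerivAt_fst.comp p hasFDerivAt_snd
  have h₃ : HasFDerivAt (fun q : ℝ × ℝ × ℝ => q.2.2)
      ((ContinuousLinearMap.snd ℝ ℝ ℝ).comp (ContinuousLinearMap.snd ℝ ℝ (ℝ × ℝ))) p :=
    hasFDerivAt_snd.comp p hasFDerivAt_snd
  have h₄ := (((h₁.const_mul (-1)).const_add M).add (h₃.const_mul m)).sub (h₂.pow 2)
  refine (h₂.prodMk (h₃.prodMk h₄)).congr_fderiv ?_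
  ext <;> simp [ghenonDeriv]

lemma det_ghenonDeriv (m y : ℝ) : LinearMap.det (ghenonDeriv m y).toLinearMap = -1 := by
  let e : (ℝ × ℝ × ℝ) ≃ₗ[ℝ] (Fin 3 → ℝ) :=
    { toFun := fun p => ![p.1, p.2.1, p.2.2]
      invFun := fun v => (v 0, v 1, v 2)
      map_add' := by intro p q; ext i; fin_cases i <;> simp
      map_smul' := by intro a p; ext i; fin_cases i <;> simp
      left_inv := by intro p; simp
      right_inv := by intro v; ext i; fin_cases i <;> simp }
  have h : (e : (ℝ × ℝ × ℝ) →ₗ[ℝ] Fin 3 → ℝ) ∘ₗ (ghenonDeriv m y).toLinearMap ∘ₗ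
      (e.symm : (Fin 3 → ℝ) →ₗ[ℝ] ℝ × ℝ × ℝ) =
      Matrix.toLin' !![0, 1, 0; 0, 0, 1; -1, -2 * y, m] := by
    refine LinearMap.ext fun v => ?_
    change e (ghenonDeriv m y (v 0, v 1, v 2)) = _
    rw [ghenonDeriv_apply]
    change ![v 1, v 2, -v 0 + m * v 2 - 2 * y * v 1] = _
    ext i
    fin_cases i <;> simp [Matrix.mulVec, dotProduct, Fin.sum_univ_three]
    ring
  rw [← LinearMap.det_conj _ e, h, LinearMap.det_toLin', Matrix.det_fin_three]
  simp

/-- The derivative of an iterate is the product of the derivatives along the orbit. -/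
lemma hasFDerivAt_ghenon_iterate_six {M m : ℝ} {p : ℝ × ℝ × ℝ} :
    HasFDerivAt (ghenon M m (-1))^[6]
      ((ghenonDeriv m ((ghenon M m (-1))^[5] p).2.1).comp
        ((ghenonDeriv m ((ghenon M m (-1))^[4] p).2.1).comp
          ((ghenonDeriv m ((ghenon M m (-1))^[3] p).2.1).comp
            ((ghenonDeriv m ((ghenon M m (-1))^[2] p).2.1).comp
              ((ghenonDeriv m ((ghenon M m (-1))^[1] p).2.1).comp
                (ghenonDeriv m p.2.1)))))) p := by
  have h : ∀ q, HasFDerivAt (ghenon M m (-1)) (ghenonDeriv m q.2.1) q := hasFDerivAt_ghenon_s16 M m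
  exact (h _).comp p ((h _).comp p ((h _).comp p ((h _).comp p ((h _).comp p (h p)))))

/-- A linear endomorphism of a three-dimensional space with determinant one and eigenvalues `1`
and `-1` has characteristic polynomial `(X + 1) ^ 2 * (X - 1)`. -/
lemma charpoly_eq_of_eigenvectors {V : Type*} [AddCommGroup V] [Module ℝ V]
    [FiniteDimensional ℝ V] (hV : Module.finrank ℝ V = 3) (f : V →ₗ[ℝ] V)
    (hdet : LinearMap.det f = 1) {v w : V} (hv : v ≠ 0) (hfv : f v = v) (hw : w ≠ 0)
    (hfw : f w = -w) : f.charpoly = (X + 1) ^ 2 * (X - 1) := by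
  have h₁ : f.charpoly.eval 1 = 0 := by
    refine (Module.End.hasEigenvalue_iff_isRoot_charpoly f 1).mp ?_
    exact Module.End.hasEigenvalue_of_hasEigenvector
      ⟨Module.End.mem_eigenspace_iff.mpr (by simpa using hfv), hv⟩
  have h₂ : f.charpoly.eval (-1) = 0 := by
    refine (Module.End.hasEigenvalue_iff_isRoot_charpoly f (-1)).mp ?_
    exact Module.End.hasEigenvalue_of_hasEigenvector
      ⟨Module.End.mem_eigenspace_iff.mpr (by simpa using hfw), hw⟩
  have h₃ : f.charpoly.coeff 0 = -1 := by
    have := LinearMap.det_eq_sign_charpoly_coeff f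
    rw [hdet, hV] at this
    linarith
  have hdeg : f.charpoly.natDegree = 3 := by rw [LinearMap.charpoly_natDegree, hV]
  have h₄ : f.charpoly.coeff 3 = 1 := by
    rw [← hdeg]
    exact f.charpoly_monic
  rw [Polynomial.eval_eq_sum_range, hdeg] at h₁ h₂
  simp only [Finset.sum_range_succ, Finset.sum_range_zero, h₃, h₄] at h₁ h₂
  have h₅ : f.charpoly.coeff 1 = -1 := by linarith
  have h₆ : f.charpoly.coeff 2 = 1 := by linarith
  rw [f.charpoly.as_sum_range_C_mul_X_pow, hdeg]
  simp only [Finset.sum_range_succ, Finset.sum_range_zero, h₃, h₄, h₅, h₆]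
  simp only [map_neg, map_one]
  ring

/-- The trace is minus the subleading coefficient of the characteristic polynomial. -/
lemma trace_eq_neg_charpoly_coeff_two {V : Type*} [AddCommGroup V] [Module ℝ V]
    [FiniteDimensional ℝ V] (hV : Module.finrank ℝ V = 3) (f : V →ₗ[ℝ] V) :
    LinearMap.trace ℝ V f = -f.charpoly.coeff 2 := by
  let b := Module.finBasisOfFinrankEq ℝ V hV
  rw [LinearMap.trace_eq_matrix_trace ℝ b, Matrix.trace_eq_neg_charpoly_coeff,
    LinearMap.charpoly_toMatrix]
  simp

end Henon

/-- There exist parameters `M̂₁ ≈ 0.3974562084897318`, `M̂₂ ≈ 0.2271356235631268` such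
that for `B̂ = −1` the inverse-form 3D Hénon map has a point of exact period 6 at which
`trace D(G⁶) = −1` and `det(D(G⁶) − I) = 0`; together with `det D(G⁶) = B̂⁶ = 1`, the
Jacobian of the sixth iterate there has eigenvalues `(−1, −1, +1)`. -/
theorem ghenon_period_six_lorenz_point_nonorientable :
    ∃ M₁ M₂ : ℝ,
      |M₁ - 0.3974562084897318| < 0.001 ∧ |M₂ - 0.2271356235631268| < 0.001 ∧
      ∃ p : ℝ × ℝ × ℝ,
        (ghenon M₁ M₂ (-1))^[6] p = p ∧
        (∀ j : ℕ, 1 ≤ j → j ≤ 5 → (ghenon M₁ M₂ (-1))^[j] p ≠ p) ∧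
        LinearMap.trace ℝ (ℝ × ℝ × ℝ)
            (fderiv ℝ ((ghenon M₁ M₂ (-1))^[6]) p).toLinearMap = -1 ∧
        LinearMap.det
            ((fderiv ℝ ((ghenon M₁ M₂ (-1))^[6]) p).toLinearMap - LinearMap.id) = 0 ∧
        LinearMap.det (fderiv ℝ ((ghenon M₁ M₂ (-1))^[6]) p).toLinearMap = 1 ∧
        LinearMap.charpoly (fderiv ℝ ((ghenon M₁ M₂ (-1))^[6]) p).toLinearMap =
          (X + 1) ^ 2 * (X - 1) := by
  obtain ⟨u, hu, hF⟩ := exists_periodSixSystem_eq_zero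
  have hb : ∀ i, |u i - (approxZero i : ℝ) / 10 ^ 6| ≤ 1 / 10 ^ 4 := fun i =>
    (dist_le_pi_dist u _ i).trans hu
  have hb0 := abs_le.mp (hb 0)
  have hb1 := abs_le.mp (hb 1)
  have hb2 := abs_le.mp (hb 2)
  have hb3 := abs_le.mp (hb 3)
  have hb4 := abs_le.mp (hb 4)
  have hb5 := abs_le.mp (hb 5)
  have hb6 := abs_le.mp (hb 6)
  have hb7 := abs_le.mp (hb 7)
  simp only [approxZero, Matrix.cons_val] at hb0 hb1 hb2 hb3 hb4 hb5 hb6 hb7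
  norm_num at hb0 hb1 hb2 hb3 hb4 hb5 hb6 hb7
  have hE : ∀ i, periodSixSystem u i = 0 := fun i => congrFun hF i
  simp only [Fin.forall_fin_succ, periodSixSystem, Matrix.cons_val_zero, Matrix.cons_val_succ] at hE
  obtain ⟨x0, x1, x2, x3, x4, x5, v0, v1, v2, v3, v4, v5, w0, w1, w2, w3, w4, w5, -⟩ := hE
  refine ⟨u 6, u 7, ?_, ?_, (u 0, u 1, u 2), ?_⟩
  · rw [abs_lt]; norm_num; constructor <;> linarith
  · rw [abs_lt]; norm_num; constructor <;> linarith
  have hstep : ∀ {a b c d : ℝ}, d - (u 6 - a + u 7 * c - b ^ 2) = 0 →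
      ghenon (u 6) (u 7) (-1) (a, b, c) = (b, c, d) := by
    intro a b c d h
    have : d = u 6 + -1 * a + u 7 * c - b ^ 2 := by linarith
    rw [this]
    rfl
  have g1 : (ghenon (u 6) (u 7) (-1))^[1] (u 0, u 1, u 2) = (u 1, u 2, u 3) := hstep x0
  have g2 : (ghenon (u 6) (u 7) (-1))^[2] (u 0, u 1, u 2) = (u 2, u 3, u 4) := by
    rw [Function.iterate_succ_apply', g1, hstep x1]
  have g3 : (ghenon (u 6) (u 7) (-1))^[3] (u 0, u 1, u 2) = (u 3, u 4, u 5) := by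
    rw [Function.iterate_succ_apply', g2, hstep x2]
  have g4 : (ghenon (u 6) (u 7) (-1))^[4] (u 0, u 1, u 2) = (u 4, u 5, u 0) := by
    rw [Function.iterate_succ_apply', g3, hstep x3]
  have g5 : (ghenon (u 6) (u 7) (-1))^[5] (u 0, u 1, u 2) = (u 5, u 0, u 1) := by
    rw [Function.iterate_succ_apply', g4, hstep x4]
  have g6 : (ghenon (u 6) (u 7) (-1))^[6] (u 0, u 1, u 2) = (u 0, u 1, u 2) := by
    rw [Function.iterate_succ_apply', g5, hstep x5]
  have hD := (hasFDerivAt_ghenon_iterate_six (M := u 6) (m := u 7) (p := (u 0, u 1, u 2))).fderiv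
  rw [g1, g2, g3, g4, g5] at hD
  set f := fderiv ℝ (ghenon (u 6) (u 7) (-1))^[6] (u 0, u 1, u 2)
  have hJ : ∀ y a b c d : ℝ, d + a + 2 * y * b - u 7 * c = 0 →
      ghenonDeriv (u 7) y (a, b, c) = (b, c, d) := by
    intro y a b c d h
    rw [ghenonDeriv_apply, show -a + u 7 * c - 2 * y * b = d by linarith]
  have hv : f.toLinearMap (1, u 8, u 9) = (1, u 8, u 9) := by
    change f (1, u 8, u 9) = _
    simp only [hD, ContinuousLinearMap.comp_apply]
    rw [hJ (u 1) 1 (u 8) (u 9) (u 10) (by linarith),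
      hJ (u 2) (u 8) (u 9) (u 10) (u 11) (by linarith),
      hJ (u 3) (u 9) (u 10) (u 11) (u 12) (by linarith),
      hJ (u 4) (u 10) (u 11) (u 12) 1 (by linarith),
      hJ (u 5) (u 11) (u 12) 1 (u 8) (by linarith),
      hJ (u 0) (u 12) 1 (u 8) (u 9) (by linarith)]
  have hw : f.toLinearMap (u 13, u 14, u 15) = -(u 13, u 14, u 15) := by
    change f (u 13, u 14, u 15) = _
    simp only [hD, ContinuousLinearMap.comp_apply]
    rw [hJ (u 1) (u 13) (u 14) (u 15) 1 (by linarith),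
      hJ (u 2) (u 14) (u 15) 1 (u 16) (by linarith),
      hJ (u 3) (u 15) 1 (u 16) (u 17) (by linarith),
      hJ (u 4) 1 (u 16) (u 17) (-u 13) (by linarith),
      hJ (u 5) (u 16) (u 17) (-u 13) (-u 14) (by linarith),
      hJ (u 0) (u 17) (-u 13) (-u 14) (-u 15) (by linarith)]
    rfl
  have hw0 : (u 13, u 14, u 15) ≠ 0 := by
    intro h
    simp only [Prod.mk_eq_zero] at h
    obtain ⟨h13, h14, h15⟩ := h
    simp [h13, h14, h15] at w0
  have hdet : LinearMap.det f.toLinearMap = 1 := by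
    simp only [hD, ContinuousLinearMap.toLinearMap_comp, LinearMap.det_comp, det_ghenonDeriv]
    norm_num
  have hrank : Module.finrank ℝ (ℝ × ℝ × ℝ) = 3 := by simp
  have hchar := charpoly_eq_of_eigenvectors hrank f.toLinearMap hdet (by simp) hv hw0 hw
  refine ⟨g6, ?_, ?_, ?_, hdet, hchar⟩
  · intro j hj1 hj5 h
    have h' := congrArg Prod.fst h
    interval_cases j
    · rw [g1] at h'; dsimp only at h'; linarith
    · rw [g2] at h'; dsimp only at h'; linarith
    · rw [g3] at h'; dsimp only at h'; linarith
    · rw [g4] at h'; dsimp only at h'; linarith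
    · rw [g5] at h'; dsimp only at h'; linarith
  · rw [trace_eq_neg_charpoly_coeff_two hrank, hchar,
      show ((X + 1) ^ 2 * (X - 1) : ℝ[X]) = X ^ 3 + X ^ 2 - X - 1 by ring]
    simp [coeff_X, coeff_one]
  · by_contra hne
    have hinj := LinearMap.ker_eq_bot.mp (by
      by_contra hker
      exact hne (LinearMap.det_eq_zero_iff_ker_ne_bot.mpr hker))
    have h0 : (f.toLinearMap - LinearMap.id : ℝ × ℝ × ℝ →ₗ[ℝ] ℝ × ℝ × ℝ) (1, u 8, u 9) =
        0 := by
      rw [LinearMap.sub_apply, hv, LinearMap.id_apply, sub_self]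
    have := hinj (h0.trans (map_zero _).symm)
    simp at this
end

section
/- For the parameter values (M̂₁, M̂₂, B̂) = (−1/4, −1, 1), the inverse-form 3D Hénon map G has the fixed point p = (−1/2, −1/2, −1/2), and the characteristic polynomial of the Jacobian matrix DG(p) equals (X + 1)²·(X − 1); i.e., the fixed point has the triplet of multipliers (−1, −1, +1). -/
open Polynomial

/-- The standard basis of `ℝ × ℝ × ℝ`. -/
noncomputable def tripleBasis : Module.Basis (Fin 3) ℝ (ℝ × ℝ × ℝ) :=
  Module.Basis.ofEquivFun
    { toFun := fun p => ![p.1, p.2.1, p.2.2]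
      invFun := fun v => (v 0, v 1, v 2)
      map_add' := fun p q => by ext i; fin_cases i <;> rfl
      map_smul' := fun c p => by ext i; fin_cases i <;> rfl
      left_inv := fun p => rfl
      right_inv := fun v => by ext i; fin_cases i <;> rfl }

theorem tripleBasis_apply (i : Fin 3) :
    tripleBasis i = ((Pi.single i 1 : Fin 3 → ℝ) 0, (Pi.single i 1 : Fin 3 → ℝ) 1,
      (Pi.single i 1 : Fin 3 → ℝ) 2) := by
  rw [tripleBasis, Module.Basis.coe_ofEquivFun]
  rfl

theorem tripleBasis_repr (p : ℝ × ℝ × ℝ) (i : Fin 3) :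
    tripleBasis.repr p i = ![p.1, p.2.1, p.2.2] i := rfl

theorem fderiv_ghenon_apply (M₁ M₂ B : ℝ) (p v : ℝ × ℝ × ℝ) :
    fderiv ℝ (ghenon M₁ M₂ B) p v =
      (v.2.1, v.2.2, B * v.1 + M₂ * v.2.2 - 2 * p.2.1 * v.2.1) := by
  have hx : HasFDerivAt (fun q : ℝ × ℝ × ℝ => q.1) (ContinuousLinearMap.fst ℝ ℝ (ℝ × ℝ)) p :=
    hasFDerivAt_fst
  have hyz : HasFDerivAt (fun q : ℝ × ℝ × ℝ => q.2) (ContinuousLinearMap.snd ℝ ℝ (ℝ × ℝ)) p :=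
    hasFDerivAt_snd
  have h : HasFDerivAt (ghenon M₁ M₂ B) _ p := hyz.fst.prodMk (hyz.snd.prodMk
    ((((hx.const_mul B).const_add M₁).add (hyz.snd.const_mul M₂)).sub (hyz.fst.pow 2)))
  rw [h.fderiv]
  simp

theorem toMatrix_fderiv_ghenon (M₁ M₂ B : ℝ) (p : ℝ × ℝ × ℝ) :
    LinearMap.toMatrix tripleBasis tripleBasis (fderiv ℝ (ghenon M₁ M₂ B) p).toLinearMap =
      !![0, 1, 0; 0, 0, 1; B, -(2 * p.2.1), M₂] := by
  ext i j
  rw [LinearMap.toMatrix_apply, tripleBasis_repr, ContinuousLinearMap.coe_coe,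
    fderiv_ghenon_apply, tripleBasis_apply]
  fin_cases i <;> fin_cases j <;> simp

theorem charpoly_fderiv_ghenon (M₁ M₂ B : ℝ) (p : ℝ × ℝ × ℝ) :
    LinearMap.charpoly (fderiv ℝ (ghenon M₁ M₂ B) p).toLinearMap =
      X ^ 3 - C M₂ * X ^ 2 + C (2 * p.2.1) * X - C B := by
  rw [← LinearMap.charpoly_toMatrix _ tripleBasis, toMatrix_fderiv_ghenon, Matrix.charpoly,
    Matrix.det_fin_three]
  simp
  ring

/-- For `(M̂₁, M̂₂, B̂) = (−1/4, −1, 1)` the inverse-form 3D Hénon map has the fixed point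
`(−1/2, −1/2, −1/2)`, with multipliers `(−1, −1, +1)`: the characteristic polynomial of
the Jacobian there is `(X + 1)²·(X − 1)`. -/
theorem ghenon_fixed_point_minus_one_minus_one_one :
    ghenon (-1/4) (-1) 1 (-1/2, -1/2, -1/2) = (-1/2, -1/2, -1/2) ∧
    LinearMap.charpoly
        (fderiv ℝ (ghenon (-1/4) (-1) 1) (-1/2, -1/2, -1/2)).toLinearMap =
      (X + 1) ^ 2 * (X - 1) := by
  refine ⟨by norm_num [ghenon], ?_⟩
  rw [charpoly_fderiv_ghenon]
  norm_num
  ring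
end
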